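/- Let k ≥ 4, l ∈ {0,1,2}, and φ(x) = |x|². The formal adjoint 𝒟_l^⋆ of 𝒟_l with respect to the weighted inner product ⟨·,·⟩_φ is given, for f ∈ C₀^∞(ℝ⁶, V_{l+1}), by (𝒟_l^⋆ f)^{A₁…A_l}_{B₁…B_{k−l}} = −Σ_{E=1}^4 Θ_{E(B₁} f^{EA₁…A_l}_{B₂…B_{k−l})}, where (⋯) symmetrizes the subscripts B₁,…,B_{k−l}; that is, ⟨𝒟_l g, f⟩_φ = ⟨g, 𝒟_l^⋆ f⟩_φ for all g ∈ C₀^∞(ℝ⁶, V_l). -/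

import Mathlib

open scoped BigOperators ComplexConjugate ENNReal
open MeasureTheory

set_option maxHeartbeats 1000000

noncomputable section

/-- The index set `{1,2,3,4}` of spinor indices. -/
abbrev Idx := Fin 4

/-- Tensors with `q` (antisymmetric) superscripts and `p` (symmetric) subscripts,
each index ranging over `{1,2,3,4}`. -/
abbrev Tens (q p : ℕ) := (Fin q → Idx) → (Fin p → Idx) → ℂ

/-- Symmetry in the subscripts. -/
def SymSub {q p : ℕ} (f : Tens q p) : Prop :=
  ∀ (A : Fin q → Idx) (σ : Equiv.Perm (Fin p)) (B : Fin p → Idx), f A (B ∘ σ) = f A B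

/-- Antisymmetry in the superscripts. -/
def AntiSup {q p : ℕ} (f : Tens q p) : Prop :=
  ∀ (σ : Equiv.Perm (Fin q)) (A : Fin q → Idx) (B : Fin p → Idx),
    f (A ∘ σ) B = ((Equiv.Perm.sign σ : ℤ) : ℂ) * f A B

/-- Membership in `V_l = ⊙^p ℂ⁴ ⊗ ∧^q ℂ⁴`: symmetric in subscripts, antisymmetric in
superscripts. -/
def IsMixed {q p : ℕ} (f : Tens q p) : Prop := AntiSup f ∧ SymSub f

/-- Symmetrization `ξ_{(B₁…B_t)}` of a `t`-index tensor. -/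
def symmetrize {t : ℕ} (ξ : (Fin t → Idx) → ℂ) : (Fin t → Idx) → ℂ :=
  fun B => ((t.factorial : ℂ))⁻¹ * ∑ σ : Equiv.Perm (Fin t), ξ (B ∘ σ)

/-- Antisymmetrization `ξ_{[B₁…B_t]}` of a `t`-index tensor. -/
def antisymmetrize {t : ℕ} (ξ : (Fin t → Idx) → ℂ) : (Fin t → Idx) → ℂ :=
  fun B => ((t.factorial : ℂ))⁻¹ * ∑ σ : Equiv.Perm (Fin t),
    ((Equiv.Perm.sign σ : ℤ) : ℂ) * ξ (B ∘ σ)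

/-- The contraction `𝒞(f)^{A₁…A_{q}}_{B₁…B_{p}} = Σ_C f^{C A₁…A_q}_{B₁…B_p C}`. -/
def contr {q p : ℕ} (f : Tens (q+1) (p+1)) : Tens q p :=
  fun A B => ∑ C : Idx, f (Fin.cons C A) (Fin.snoc B C)

/-- The Hermitian inner product on tensors, induced from `⊗^k ℂ⁴`. -/
def tinner {q p : ℕ} (f h : Tens q p) : ℂ :=
  ∑ A : Fin q → Idx, ∑ B : Fin p → Idx, f A B * conj (h A B)

/-- The squared norm of a tensor. -/
def tnormSq {q p : ℕ} (f : Tens q p) : ℝ :=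
  ∑ A : Fin q → Idx, ∑ B : Fin p → Idx, Complex.normSq (f A B)
/-- Points of `ℝ⁶`, with coordinates `x 0, …, x 5`. -/
abbrev Pt := Fin 6 → ℝ

/-- Coefficients (in front of `∂_{x_j}`) of the operators `∇^{AB}`:
`∇^{12}=i∂₀+∂₅`, `∇^{13}=∂₃+i∂₄`, `∇^{14}=∂₁+i∂₂`, `∇^{23}=∂₁−i∂₂`,
`∇^{24}=−∂₃+i∂₄`, `∇^{34}=−i∂₀+∂₅`, antisymmetric. -/
def nablaCoeff : Fin 4 → Fin 4 → Fin 6 → ℂ :=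
  ![![(0 : Fin 6 → ℂ), ![Complex.I,0,0,0,0,1], ![0,0,0,1,Complex.I,0], ![0,1,Complex.I,0,0,0]],
    ![-![Complex.I,0,0,0,0,1], (0 : Fin 6 → ℂ), ![0,1,-Complex.I,0,0,0], ![0,0,0,-1,Complex.I,0]],
    ![-![0,0,0,1,Complex.I,0], -![0,1,-Complex.I,0,0,0], (0 : Fin 6 → ℂ), ![-Complex.I,0,0,0,0,1]],
    ![-![0,1,Complex.I,0,0,0], -![0,0,0,-1,Complex.I,0], -![-Complex.I,0,0,0,0,1], (0 : Fin 6 → ℂ)]]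

/-- The partial derivative `∂_{x_j} u (x)` of a complex valued function on `ℝ⁶`. -/
def pd (j : Fin 6) (u : Pt → ℂ) (x : Pt) : ℂ := fderiv ℝ u x (Pi.single j 1)

/-- The first order constant coefficient differential operator `∇^{AB}`. -/
def nabla (A B : Fin 4) (u : Pt → ℂ) (x : Pt) : ℂ :=
  ∑ j : Fin 6, nablaCoeff A B j * pd j u x

/-- `ε_{ABCD}`: the sign of the permutation `(1,2,3,4) ↦ (A,B,C,D)`, `0` if indices repeat. -/
def eps (A B C D : Fin 4) : ℤ :=
  if h : Function.Bijective ![A,B,C,D] then (Equiv.Perm.sign (Equiv.ofBijective _ h) : ℤ) else 0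

/-- The lowered operator `∇_{AB} := (1/2) Σ_{C,D} ε_{ABCD} ∇^{CD}`. -/
def nablaLow (A B : Fin 4) (u : Pt → ℂ) (x : Pt) : ℂ :=
  (2 : ℂ)⁻¹ * ∑ C : Fin 4, ∑ D : Fin 4, ((eps A B C D : ℤ) : ℂ) * nabla C D u x

/-- The weight `φ(x) = |x|²`. -/
def phi (x : Pt) : ℝ := ∑ j : Fin 6, (x j)^2

/-- `Θ_{AB} u := −e^{φ} ∇_{AB}(e^{−φ} u)`, the formal adjoint of `∇^{AB}` in `L²_φ`. -/
def Theta (A B : Fin 4) (u : Pt → ℂ) (x : Pt) : ℂ :=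
  - (Real.exp (phi x) : ℂ) * nablaLow A B (fun y => (Real.exp (-(phi y)) : ℂ) * u y) x

/-- The operator `𝒟_l`:
`(𝒟_l f)^{A₁…A_{l+1}}_{B₂…B_{k−l}} = Σ_{B₁} ∇^{B₁[A₁} f^{A₂…A_{l+1}]}_{B₁B₂…B_{k−l}}`,
where `[⋯]` antisymmetrizes the superscripts. -/
def Dop {q p : ℕ} (u : Pt → Tens q (p+1)) (x : Pt) : Tens (q+1) p :=
  fun A B => antisymmetrize
    (fun A' => ∑ B₁ : Idx, nabla B₁ (A' 0) (fun y => u y (Fin.tail A') (Fin.cons B₁ B)) x) A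

/-- The formal adjoint `𝒟_l^⋆`:
`(𝒟_l^⋆ f)^{A₁…A_l}_{B₁…B_{k−l}} = −Σ_E Θ_{E(B₁} f^{EA₁…A_l}_{B₂…B_{k−l})}`,
where `(⋯)` symmetrizes the subscripts. -/
def DopStar {q p : ℕ} (u : Pt → Tens (q+1) p) (x : Pt) : Tens q (p+1) :=
  fun A B => - symmetrize
    (fun B' => ∑ E : Idx, Theta E (B' 0) (fun y => u y (Fin.cons E A) (Fin.tail B')) x) B

/-- A tensor-valued function is smooth iff all its components are. -/
def TensSmooth {q p : ℕ} (u : Pt → Tens q p) : Prop :=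
  ∀ A B, ContDiff ℝ (⊤ : ℕ∞) fun x => u x A B

/-- A tensor-valued function is compactly supported iff all its components are. -/
def TensCpt {q p : ℕ} (u : Pt → Tens q p) : Prop :=
  ∀ A B, HasCompactSupport fun x => u x A B

/-- Twelve times the Levi-Civita symbol is the Vandermonde product of its indices. -/
theorem twelve_mul_eps (A B C D : Fin 4) :
    12 * eps A B C D = ((B : ℤ) - A) * ((C : ℤ) - A) * ((D : ℤ) - A) *
      ((C : ℤ) - B) * ((D : ℤ) - B) * ((D : ℤ) - C) := by
  revert A B C D
  decide +kernel

theorem nablaCoeff_swap (A B : Fin 4) (j : Fin 6) :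
    nablaCoeff A B j = -nablaCoeff B A j := by
  fin_cases A <;> fin_cases B <;> fin_cases j <;> simp [nablaCoeff]

/-- Lowering the indices of `∇^{AB}` conjugates its coefficients. -/
theorem sum_eps_mul_nablaCoeff (A B : Fin 4) (j : Fin 6) :
    (2 : ℂ)⁻¹ * ∑ C : Fin 4, ∑ D : Fin 4, ((eps A B C D : ℤ) : ℂ) * nablaCoeff C D j
      = conj (nablaCoeff A B j) := by
  have h (C D : Fin 4) : ((eps A B C D : ℤ) : ℂ) =
      (((B : ℤ) - A) * ((C : ℤ) - A) * ((D : ℤ) - A) *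
      ((C : ℤ) - B) * ((D : ℤ) - B) * ((D : ℤ) - C) : ℤ) / 12 := by
    rw [← twelve_mul_eps]; push_cast; ring
  simp only [h, Fin.sum_univ_four]
  fin_cases A <;> fin_cases B <;> fin_cases j <;>
    simp [nablaCoeff] <;> ring

theorem nablaLow_eq_sum_conj (A B : Fin 4) (u : Pt → ℂ) (x : Pt) :
    nablaLow A B u x = ∑ j : Fin 6, conj (nablaCoeff A B j) * pd j u x := by
  simp only [nablaLow, nabla, ← sum_eps_mul_nablaCoeff, Fin.sum_univ_four, Finset.mul_sum,
    ← Finset.sum_add_distrib]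
  exact Finset.sum_congr rfl fun j _ => by ring

theorem contDiff_exp_neg_phi : ContDiff ℝ (⊤ : ℕ∞) fun x : Pt => (Real.exp (-(phi x)) : ℂ) := by
  have h : ContDiff ℝ (⊤ : ℕ∞) fun x : Pt => Real.exp (-(phi x)) := by
    unfold phi; fun_prop
  exact Complex.ofRealCLM.contDiff.comp h

theorem pd_conj (j : Fin 6) (u : Pt → ℂ) (x : Pt) :
    pd j (fun y => conj (u y)) x = conj (pd j u x) := by
  have := (Complex.conjCLE).comp_fderiv (f := u) (x := x)
  exact congrArg (fun L => L (Pi.single j 1)) this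

theorem integrable_mul_of_hasCompactSupport {u v : Pt → ℂ} (hu : Continuous u)
    (hcu : HasCompactSupport u) (hv : Continuous v) :
    Integrable fun x => u x * v x :=
  (hu.mul hv).integrable_of_hasCompactSupport hcu.mul_right

theorem continuous_pd (j : Fin 6) {u : Pt → ℂ} (hu : ContDiff ℝ (⊤ : ℕ∞) u) :
    Continuous (pd j u) :=
  (hu.continuous_fderiv (by simp)).clm_apply continuous_const

theorem hasCompactSupport_pd (j : Fin 6) {u : Pt → ℂ} (hu : HasCompactSupport u) :
    HasCompactSupport (pd j u) :=
  hu.fderiv_apply ℝ _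

/-- Integration by parts on `ℝ⁶`. -/
theorem integral_pd_mul (j : Fin 6) {u v : Pt → ℂ} (hu : ContDiff ℝ (⊤ : ℕ∞) u)
    (hcu : HasCompactSupport u) (hv : ContDiff ℝ (⊤ : ℕ∞) v) :
    ∫ x, pd j u x * v x = -∫ x, u x * pd j v x := by
  have h := integral_mul_fderiv_eq_neg_fderiv_mul_of_integrable (μ := volume) (f := u) (g := v)
    (v := Pi.single j 1)
    (integrable_mul_of_hasCompactSupport (continuous_pd j hu) (hasCompactSupport_pd j hcu)
      hv.continuous)
    (integrable_mul_of_hasCompactSupport hu.continuous hcu (continuous_pd j hv))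
    (integrable_mul_of_hasCompactSupport hu.continuous hcu hv.continuous)
    (fun x _ => hu.differentiable (by simp) x) (fun x _ => hv.differentiable (by simp) x)
  simp only [pd, h, neg_neg]

theorem conj_Theta_mul_exp (A B : Fin 4) (v : Pt → ℂ) (x : Pt) :
    conj (Theta A B v x) * (Real.exp (-(phi x)) : ℂ) =
      ∑ j : Fin 6, nablaCoeff B A j *
        pd j (fun y => conj (v y) * (Real.exp (-(phi y)) : ℂ)) x := by
  have hexp : (Real.exp (phi x) : ℂ) * (Real.exp (-(phi x)) : ℂ) = 1 := by
    rw [← Complex.ofReal_mul, ← Real.exp_add]; simp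
  have hconj : (fun y => conj (v y) * (Real.exp (-(phi y)) : ℂ)) =
      fun y => conj ((Real.exp (-(phi y)) : ℂ) * v y) := by
    funext y; rw [map_mul, Complex.conj_ofReal, mul_comm]
  simp only [hconj, pd_conj]
  simp only [Theta, nablaLow_eq_sum_conj, nablaCoeff_swap B A, map_mul, map_neg, map_sum,
    Complex.conj_conj, Complex.conj_ofReal, neg_mul, Finset.sum_neg_distrib]
  rw [mul_right_comm, hexp, one_mul]

theorem integrable_nabla_mul (A B : Fin 4) {u v : Pt → ℂ} (hu : ContDiff ℝ (⊤ : ℕ∞) u)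
    (hcu : HasCompactSupport u) (hv : ContDiff ℝ (⊤ : ℕ∞) v) :
    Integrable fun x => nabla A B u x * conj (v x) * (Real.exp (-(phi x)) : ℂ) := by
  simp only [nabla, mul_assoc, Finset.sum_mul]
  refine integrable_finsetSum _ fun j _ => Integrable.const_mul ?_ _
  exact integrable_mul_of_hasCompactSupport (continuous_pd j hu) (hasCompactSupport_pd j hcu)
    ((Complex.continuous_conj.comp hv.continuous).mul contDiff_exp_neg_phi.continuous)

theorem contDiff_conj_mul_exp {v : Pt → ℂ} (hv : ContDiff ℝ (⊤ : ℕ∞) v) :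
    ContDiff ℝ (⊤ : ℕ∞) fun x => conj (v x) * (Real.exp (-(phi x)) : ℂ) :=
  (Complex.conjCLE.contDiff.comp hv).mul contDiff_exp_neg_phi

theorem integrable_mul_Theta (A B : Fin 4) {u v : Pt → ℂ} (hu : ContDiff ℝ (⊤ : ℕ∞) u)
    (hcu : HasCompactSupport u) (hv : ContDiff ℝ (⊤ : ℕ∞) v) :
    Integrable fun x => u x * conj (Theta A B v x) * (Real.exp (-(phi x)) : ℂ) := by
  simp only [mul_assoc, conj_Theta_mul_exp]
  exact integrable_mul_of_hasCompactSupport hu.continuous hcu <| continuous_finsetSum _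
    fun j _ => continuous_const.mul (continuous_pd j (contDiff_conj_mul_exp hv))

/-- `Θ_{AB}` is the formal adjoint of `∇^{AB} = -∇^{BA}` in the weighted `L²` space. -/
theorem integral_nabla_mul_conj (A B : Fin 4) {u v : Pt → ℂ} (hu : ContDiff ℝ (⊤ : ℕ∞) u)
    (hcu : HasCompactSupport u) (hv : ContDiff ℝ (⊤ : ℕ∞) v) :
    ∫ x, nabla B A u x * conj (v x) * (Real.exp (-(phi x)) : ℂ) =
      -∫ x, u x * conj (Theta A B v x) * (Real.exp (-(phi x)) : ℂ) := by
  have hw := contDiff_conj_mul_exp hv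
  simp only [nabla, mul_assoc, conj_Theta_mul_exp, Finset.sum_mul, Finset.mul_sum]
  simp only [mul_left_comm (u _)]
  rw [integral_finsetSum, integral_finsetSum, ← Finset.sum_neg_distrib]
  · refine Finset.sum_congr rfl fun j _ => ?_
    rw [integral_const_mul, integral_const_mul, integral_pd_mul j hu hcu hw, mul_neg]
  · exact fun j _ => (integrable_mul_of_hasCompactSupport hu.continuous hcu
      (continuous_pd j hw)).const_mul _
  · exact fun j _ => (integrable_mul_of_hasCompactSupport (continuous_pd j hu)
      (hasCompactSupport_pd j hcu) hw.continuous).const_mul _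

theorem sum_antisymmetrize_mul {t : ℕ} (ξ η : (Fin t → Idx) → ℂ)
    (hη : ∀ (σ : Equiv.Perm (Fin t)) A, η (A ∘ σ) = ((Equiv.Perm.sign σ : ℤ) : ℂ) * η A) :
    ∑ A, antisymmetrize ξ A * conj (η A) = ∑ A, ξ A * conj (η A) := by
  have hσ (σ : Equiv.Perm (Fin t)) :
      ∑ A : Fin t → Idx, ((Equiv.Perm.sign σ : ℤ) : ℂ) * ξ (A ∘ σ) * conj (η A) =
        ∑ A, ξ A * conj (η A) := by
    rw [← (Equiv.arrowCongr σ.symm (Equiv.refl Idx)).sum_comp fun A => ξ A * conj (η A)]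
    refine Finset.sum_congr rfl fun A _ => ?_
    have : (Equiv.arrowCongr σ.symm (Equiv.refl Idx)) A = A ∘ σ := rfl
    rw [this, hη, map_mul, map_intCast]
    ring
  simp only [antisymmetrize, mul_assoc, ← Finset.mul_sum, Finset.sum_mul]
  rw [Finset.sum_comm]
  simp only [← mul_assoc, hσ]
  simp [Fintype.card_perm, Nat.factorial_ne_zero]

theorem sum_mul_symmetrize {t : ℕ} (ξ η : (Fin t → Idx) → ℂ)
    (hη : ∀ (σ : Equiv.Perm (Fin t)) B, η (B ∘ σ) = η B) :
    ∑ B, η B * conj (symmetrize ξ B) = ∑ B, η B * conj (ξ B) := by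
  have hσ (σ : Equiv.Perm (Fin t)) :
      ∑ B : Fin t → Idx, η B * conj (ξ (B ∘ σ)) = ∑ B, η B * conj (ξ B) := by
    rw [← (Equiv.arrowCongr σ.symm (Equiv.refl Idx)).sum_comp fun B => η B * conj (ξ B)]
    refine Finset.sum_congr rfl fun B _ => ?_
    have : (Equiv.arrowCongr σ.symm (Equiv.refl Idx)) B = B ∘ σ := rfl
    rw [this, hη]
  simp only [symmetrize, map_mul, map_sum, Finset.mul_sum, mul_left_comm (η _)]
  rw [Finset.sum_comm]
  simp [← Finset.mul_sum, hσ, Fintype.card_perm, Nat.factorial_ne_zero]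

theorem sum_fin_succ_arrow {n : ℕ} (F : Idx → (Fin n → Idx) → ℂ) :
    ∑ A : Fin (n + 1) → Idx, F (A 0) (Fin.tail A) = ∑ E, ∑ A, F E A := by
  rw [← (Fin.consEquiv fun _ => Idx).sum_comp, Fintype.sum_prod_type]
  simp [Fin.consEquiv]

theorem tinner_Dop {q p : ℕ} (g : Pt → Tens q (p + 1)) (f : Tens (q + 1) p) (hf : AntiSup f)
    (x : Pt) :
    tinner (Dop g x) f = ∑ E, ∑ A, ∑ B, ∑ C,
      nabla C E (fun y => g y A (Fin.cons C B)) x * conj (f (Fin.cons E A) B) := by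
  rw [← sum_fin_succ_arrow fun E A => ∑ B, ∑ C,
    nabla C E (fun y => g y A (Fin.cons C B)) x * conj (f (Fin.cons E A) B)]
  simp only [tinner, Dop, Fin.cons_self_tail, ← Finset.sum_mul]
  rw [Finset.sum_comm, Finset.sum_comm (s := Finset.univ (α := Fin (q + 1) → Idx))]
  exact Finset.sum_congr rfl fun B _ =>
    sum_antisymmetrize_mul _ (fun A => f A B) fun σ A => hf σ A B

theorem tinner_DopStar {q p : ℕ} (g : Tens q (p + 1)) (f : Pt → Tens (q + 1) p) (hg : SymSub g)
    (x : Pt) :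
    tinner g (DopStar f x) = ∑ E, ∑ A, ∑ B, ∑ C,
      -(g A (Fin.cons C B) * conj (Theta E C (fun y => f y (Fin.cons E A) B) x)) := by
  have h (A : Fin q → Idx) : ∑ B, g A B * conj (DopStar f x A B) = ∑ E, ∑ B, ∑ C,
      -(g A (Fin.cons C B) * conj (Theta E C (fun y => f y (Fin.cons E A) B) x)) := by
    simp only [DopStar, map_neg, mul_neg, Finset.sum_neg_distrib]
    rw [sum_mul_symmetrize _ _ fun σ B => hg A σ B]
    simp only [map_sum, Finset.mul_sum]
    rw [Finset.sum_comm]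
    congr 1
    refine Finset.sum_congr rfl fun E _ => ?_
    rw [Finset.sum_comm, ← sum_fin_succ_arrow fun C B =>
      g A (Fin.cons C B) * conj (Theta E C (fun y => f y (Fin.cons E A) B) x)]
    simp only [Fin.cons_self_tail]
  simp only [tinner, h]
  rw [Finset.sum_comm]

/-- The formal adjoint formula for tensors with any number of indices. -/
theorem integral_tinner_Dop {q p : ℕ} (g : Pt → Tens q (p + 1)) (f : Pt → Tens (q + 1) p)
    (hg : TensSmooth g) (hcg : TensCpt g) (hsg : ∀ x, SymSub (g x))
    (hf : TensSmooth f) (haf : ∀ x, AntiSup (f x)) :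
    ∫ x, tinner (Dop g x) (f x) * (Real.exp (-(phi x)) : ℂ)
      = ∫ x, tinner (g x) (DopStar f x) * (Real.exp (-(phi x)) : ℂ) := by
  simp only [tinner_Dop g _ (haf _), tinner_DopStar _ f (hsg _), Finset.sum_mul, neg_mul]
  have hl (E : Idx) (A : Fin q → Idx) (B : Fin p → Idx) (C : Idx) :=
    integrable_nabla_mul C E (hg A (Fin.cons C B)) (hcg _ _) (hf (Fin.cons E A) B)
  have hr (E : Idx) (A : Fin q → Idx) (B : Fin p → Idx) (C : Idx) :=
    (integrable_mul_Theta E C (hg A (Fin.cons C B)) (hcg _ _) (hf (Fin.cons E A) B)).neg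
  simp only [Pi.neg_def] at hr
  rw [integral_finsetSum _ fun E _ => integrable_finsetSum _ fun A _ =>
      integrable_finsetSum _ fun B _ => integrable_finsetSum _ fun C _ => hl E A B C,
    integral_finsetSum _ fun E _ => integrable_finsetSum _ fun A _ =>
      integrable_finsetSum _ fun B _ => integrable_finsetSum _ fun C _ => hr E A B C]
  refine Finset.sum_congr rfl fun E _ => ?_
  rw [integral_finsetSum _ fun A _ => integrable_finsetSum _ fun B _ =>
      integrable_finsetSum _ fun C _ => hl E A B C,
    integral_finsetSum _ fun A _ => integrable_finsetSum _ fun B _ =>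
      integrable_finsetSum _ fun C _ => hr E A B C]
  refine Finset.sum_congr rfl fun A _ => ?_
  rw [integral_finsetSum _ fun B _ => integrable_finsetSum _ fun C _ => hl E A B C,
    integral_finsetSum _ fun B _ => integrable_finsetSum _ fun C _ => hr E A B C]
  refine Finset.sum_congr rfl fun B _ => ?_
  rw [integral_finsetSum _ fun C _ => hl E A B C, integral_finsetSum _ fun C _ => hr E A B C]
  refine Finset.sum_congr rfl fun C _ => ?_
  rw [integral_nabla_mul_conj E C (hg _ _) (hcg _ _) (hf _ _), integral_neg]

/-- For `k = m + 4 ≥ 4`, `l = 0,1,2` and `φ(x) = |x|²`, the formal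
adjoint of `𝒟_l` with respect to `⟨·,·⟩_φ` is
`(𝒟_l^⋆ f)^{A₁…A_l}_{B₁…B_{k−l}} = −Σ_E Θ_{E(B₁} f^{EA₁…A_l}_{B₂…B_{k−l})}`
(which is the map `DopStar`): `⟨𝒟_l g, f⟩_φ = ⟨g, 𝒟_l^⋆ f⟩_φ` for all
`g ∈ C₀^∞(ℝ⁶,V_l)` and `f ∈ C₀^∞(ℝ⁶,V_{l+1})`. -/
theorem Dop_formal_adjoint (k m : ℕ) (hk : k = m + 4) :
    -- l = 0
    (∀ (g : Pt → Tens 0 (m+4)) (f : Pt → Tens 1 (m+3)),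
      TensSmooth g → TensCpt g → (∀ x, IsMixed (g x)) →
      TensSmooth f → TensCpt f → (∀ x, IsMixed (f x)) →
      ∫ x, tinner (Dop g x) (f x) * (Real.exp (-(phi x)) : ℂ)
        = ∫ x, tinner (g x) (DopStar f x) * (Real.exp (-(phi x)) : ℂ)) ∧
    -- l = 1
    (∀ (g : Pt → Tens 1 (m+3)) (f : Pt → Tens 2 (m+2)),
      TensSmooth g → TensCpt g → (∀ x, IsMixed (g x)) →
      TensSmooth f → TensCpt f → (∀ x, IsMixed (f x)) →
      ∫ x, tinner (Dop g x) (f x) * (Real.exp (-(phi x)) : ℂ)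
        = ∫ x, tinner (g x) (DopStar f x) * (Real.exp (-(phi x)) : ℂ)) ∧
    -- l = 2
    (∀ (g : Pt → Tens 2 (m+2)) (f : Pt → Tens 3 (m+1)),
      TensSmooth g → TensCpt g → (∀ x, IsMixed (g x)) →
      TensSmooth f → TensCpt f → (∀ x, IsMixed (f x)) →
      ∫ x, tinner (Dop g x) (f x) * (Real.exp (-(phi x)) : ℂ)
        = ∫ x, tinner (g x) (DopStar f x) * (Real.exp (-(phi x)) : ℂ)) := by
  refine ⟨fun g f hg hcg hmg hf _ hmf => ?_, fun g f hg hcg hmg hf _ hmf => ?_,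
    fun g f hg hcg hmg hf _ hmf => ?_⟩ <;>
  exact integral_tinner_Dop g f hg hcg (fun x => (hmg x).2) hf fun x => (hmf x).1
end
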